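/- Let G be a unicyclic graph with b(G) ≥ 2. Then G contains configuration A, B, or C either with respect to every smallest biactive branch-resolving set or with respect to none of them; that is, for any two smallest biactive branch-resolving sets S and S′, G contains one of the configurations A, B, C with respect to S if and only if it contains one of them with respect to S′. -/

import Mathlib

open SimpleGraph

section Defs

variable {V : Type*}

/-- Distance from a vertex `s` to an edge `e`: the minimum of the distances to its endpoints. -/
noncomputable def edgeDist (G : SimpleGraph V) (s : V) (e : Sym2 V) : ℕ :=
  Sym2.lift ⟨fun u w => min (G.dist s u) (G.dist s w), fun u w => min_comm _ _⟩ e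

/-- `S` is a vertex metric generator of `G`. -/
def IsVertexMG (G : SimpleGraph V) (S : Set V) : Prop :=
  ∀ u v : V, u ≠ v → ∃ s ∈ S, G.dist s u ≠ G.dist s v

/-- `S` is an edge metric generator of `G`. -/
def IsEdgeMG (G : SimpleGraph V) (S : Set V) : Prop :=
  ∀ e ∈ G.edgeSet, ∀ f ∈ G.edgeSet, e ≠ f → ∃ s ∈ S, edgeDist G s e ≠ edgeDist G s f

/-- The vertex metric dimension of `G`. -/
noncomputable def metricDim (G : SimpleGraph V) : ℕ :=
  sInf {n | ∃ S : Finset V, S.card = n ∧ IsVertexMG G ↑S}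

/-- The edge metric dimension of `G`. -/
noncomputable def edgeMetricDim (G : SimpleGraph V) : ℕ :=
  sInf {n | ∃ S : Finset V, S.card = n ∧ IsEdgeMG G ↑S}

/-- `G` is unicyclic: connected, contains a cycle, and any two cycles have the same edges. -/
def IsUnicyclic (G : SimpleGraph V) : Prop :=
  G.Connected ∧ (∃ (u : V) (w : G.Walk u u), w.IsCycle) ∧
    ∀ (u u' : V) (w : G.Walk u u) (w' : G.Walk u' u'), w.IsCycle → w'.IsCycle →
      ∀ e, e ∈ w.edges ↔ e ∈ w'.edges

/-- `vc : ZMod g → V` is a labelling `v_0 v_1 ⋯ v_{g-1}` of a cycle of length `g` in `G`. -/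
def IsCycleLabelling (G : SimpleGraph V) (g : ℕ) (vc : ZMod g → V) : Prop :=
  Function.Injective vc ∧ ∀ i : ZMod g, G.Adj (vc i) (vc (i + 1))

/-- The set of edges of the cycle `C`. -/
def cycleEdges (g : ℕ) (vc : ZMod g → V) : Set (Sym2 V) :=
  {e | ∃ i : ZMod g, e = s(vc i, vc (i + 1))}

/-- The graph `G - E(C)`. -/
def offCycle (G : SimpleGraph V) (g : ℕ) (vc : ZMod g → V) : SimpleGraph V :=
  G.deleteEdges (cycleEdges g vc)

/-- `x` belongs to `T_{v_i}`, the connected component of `G - E(C)` containing `v_i`. -/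
def inTree (G : SimpleGraph V) (g : ℕ) (vc : ZMod g → V) (i : ZMod g) (x : V) : Prop :=
  (offCycle G g vc).Reachable (vc i) x

/-- The vertex `v_i` of the cycle is `S`-active: `T_{v_i}` contains a vertex of `S`. -/
def SActive (G : SimpleGraph V) (g : ℕ) (vc : ZMod g → V) (S : Set V) (i : ZMod g) : Prop :=
  ∃ s ∈ S, inTree G g vc i s

/-- `a_S(C)`: the number of `S`-active vertices on the cycle. -/
noncomputable def aS (G : SimpleGraph V) (g : ℕ) (vc : ZMod g → V) (S : Set V) : ℕ :=
  {i : ZMod g | SActive G g vc S i}.ncard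

/-- `S` is biactive: `a_S(C) ≥ 2`. -/
def Biactive (G : SimpleGraph V) (g : ℕ) (vc : ZMod g → V) (S : Set V) : Prop :=
  2 ≤ aS G g vc S

variable [Fintype V] [DecidableEq V]

/-- `t = u_1 u_2 ⋯ u_k` is a thread hanging at the vertex `v`. -/
def IsThreadAt (G : SimpleGraph V) [DecidableRel G.Adj] (v : V) (t : List V) : Prop :=
  t ≠ [] ∧ t.Nodup ∧ v ∉ t ∧ 3 ≤ G.degree v ∧ List.Chain' G.Adj t ∧
    (∀ u ∈ t.head?, G.Adj v u) ∧ (∀ u ∈ t.getLast?, G.degree u = 1) ∧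
    ∀ u ∈ t.dropLast, G.degree u = 2

/-- The thread `t` is `S`-free: it contains no vertex of `S`. -/
def SFree (S : Set V) (t : List V) : Prop := ∀ u ∈ t, u ∉ S

/-- `S` is branch-resolving: for every vertex, all threads hanging at it except possibly
one contain a vertex of `S` (i.e. at most one thread at each vertex is `S`-free). -/
def BranchResolving (G : SimpleGraph V) [DecidableRel G.Adj] (S : Set V) : Prop :=
  ∀ v : V, ∀ t₁ t₂ : List V, IsThreadAt G v t₁ → IsThreadAt G v t₂ → t₁ ≠ t₂ →
    (∃ s ∈ S, s ∈ t₁) ∨ (∃ s ∈ S, s ∈ t₂)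

/-- `ℓ(v)`: the number of threads hanging at `v`. -/
noncomputable def numThreads (G : SimpleGraph V) [DecidableRel G.Adj] (v : V) : ℕ :=
  {t : List V | IsThreadAt G v t}.ncard

/-- `L(G) = Σ (ℓ(v) - 1)` (truncated subtraction makes the sum run exactly over the
vertices with `ℓ(v) > 1`). -/
noncomputable def LG (G : SimpleGraph V) [DecidableRel G.Adj] : ℕ :=
  ∑ v : V, (numThreads G v - 1)

/-- `x` is a branching vertex of the unicyclic graph with cycle `vc`. -/
def Branching (G : SimpleGraph V) [DecidableRel G.Adj] (g : ℕ) (vc : ZMod g → V) (x : V) :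
    Prop :=
  (x ∉ Set.range vc ∧ 3 ≤ G.degree x) ∨ (x ∈ Set.range vc ∧ 4 ≤ G.degree x)

/-- The cycle vertex `v_i` is branch-active: `T_{v_i}` contains a branching vertex. -/
def BranchActive (G : SimpleGraph V) [DecidableRel G.Adj] (g : ℕ) (vc : ZMod g → V)
    (i : ZMod g) : Prop :=
  ∃ x, inTree G g vc i x ∧ Branching G g vc x

/-- `b(G)`: the number of branch-active vertices on the cycle. -/
noncomputable def bG (G : SimpleGraph V) [DecidableRel G.Adj] (g : ℕ) (vc : ZMod g → V) : ℕ :=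
  {i : ZMod g | BranchActive G g vc i}.ncard

/-- `k = max { i : v_i is S-active }` for the labelling `vc` (indices taken in `[0, g-1]`). -/
noncomputable def kOf (G : SimpleGraph V) (g : ℕ) (vc : ZMod g → V) (S : Set V) : ℕ :=
  sSup {n : ℕ | n < g ∧ SActive G g vc S (n : ZMod g)}

/-- The labelling `vc` of the cycle is canonical with respect to `S`: `v_0` is `S`-active
and `k` is as small as possible among all labellings of the cycle with `v_0` `S`-active. -/
def Canonical (G : SimpleGraph V) (g : ℕ) (vc : ZMod g → V) (S : Set V) : Prop :=
  IsCycleLabelling G g vc ∧ SActive G g vc S 0 ∧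
    ∀ vc' : ZMod g → V, IsCycleLabelling G g vc' → Set.range vc' = Set.range vc →
      SActive G g vc' S 0 → kOf G g vc S ≤ kOf G g vc' S

/-- Configuration 𝒜 : `a_S(C) = 2`, `g` even and `k = g/2`. -/
def ConfigA (G : SimpleGraph V) (g : ℕ) (vc : ZMod g → V) (S : Set V) : Prop :=
  aS G g vc S = 2 ∧ Even g ∧ kOf G g vc S = g / 2

/-- Configuration ℬ : `k ≤ ⌊g/2⌋ - 1` and an `S`-free thread hangs at `v_i` for some
`i ∈ [k, ⌊g/2⌋-1] ∪ [⌈g/2⌉+k+1, g-1] ∪ {0}`. -/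
def ConfigB (G : SimpleGraph V) [DecidableRel G.Adj] (g : ℕ) (vc : ZMod g → V) (S : Set V) :
    Prop :=
  kOf G g vc S ≤ g / 2 - 1 ∧
    ∃ i : ℕ, ((kOf G g vc S ≤ i ∧ i ≤ g / 2 - 1) ∨
        ((g + 1) / 2 + kOf G g vc S + 1 ≤ i ∧ i ≤ g - 1) ∨ i = 0) ∧
      ∃ t : List V, IsThreadAt G (vc (i : ZMod g)) t ∧ SFree S t

/-- Configuration 𝒞 : `a_S(C) = 2`, `g` even, `k ≤ g/2` and an `S`-free thread of length
`≥ g/2 - k` hangs at `v_i` for some `i ∈ [0, k]`. -/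
def ConfigC (G : SimpleGraph V) [DecidableRel G.Adj] (g : ℕ) (vc : ZMod g → V) (S : Set V) :
    Prop :=
  aS G g vc S = 2 ∧ Even g ∧ kOf G g vc S ≤ g / 2 ∧
    ∃ i : ℕ, i ≤ kOf G g vc S ∧
      ∃ t : List V, IsThreadAt G (vc (i : ZMod g)) t ∧ SFree S t ∧
        g / 2 - kOf G g vc S ≤ t.length

/-- Configuration 𝒟 : `k ≤ ⌈g/2⌉ - 1` and an `S`-free thread hangs at `v_i` for some
`i ∈ [k, ⌈g/2⌉-1] ∪ [⌊g/2⌋+k+1, g-1] ∪ {0}`. -/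
def ConfigD (G : SimpleGraph V) [DecidableRel G.Adj] (g : ℕ) (vc : ZMod g → V) (S : Set V) :
    Prop :=
  kOf G g vc S ≤ (g + 1) / 2 - 1 ∧
    ∃ i : ℕ, ((kOf G g vc S ≤ i ∧ i ≤ (g + 1) / 2 - 1) ∨
        (g / 2 + kOf G g vc S + 1 ≤ i ∧ i ≤ g - 1) ∨ i = 0) ∧
      ∃ t : List V, IsThreadAt G (vc (i : ZMod g)) t ∧ SFree S t

/-- Configuration ℰ : `a_S(C) = 2` and an `S`-free thread of length `≥ ⌊g/2⌋ - k + 1`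
hangs at `v_i` with `i ∈ [0, k]`; moreover if `g` is even an `S`-free thread hangs at
`v_j` with `j = g/2 + k - i`. -/
def ConfigE (G : SimpleGraph V) [DecidableRel G.Adj] (g : ℕ) (vc : ZMod g → V) (S : Set V) :
    Prop :=
  aS G g vc S = 2 ∧
    ∃ i : ℕ, i ≤ kOf G g vc S ∧
      (∃ t : List V, IsThreadAt G (vc (i : ZMod g)) t ∧ SFree S t ∧
        g / 2 - kOf G g vc S + 1 ≤ t.length) ∧
      (Even g → ∃ t' : List V,
        IsThreadAt G (vc ((g / 2 + kOf G g vc S - i : ℕ) : ZMod g)) t' ∧ SFree S t')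

/-- `G` contains configuration 𝒜 with respect to `S` (evaluated on a canonical labelling
of the cycle given by `vc`). -/
def ContainsA (G : SimpleGraph V) (g : ℕ) (vc : ZMod g → V) (S : Set V) : Prop :=
  ∃ vc' : ZMod g → V, IsCycleLabelling G g vc' ∧ Set.range vc' = Set.range vc ∧
    Canonical G g vc' S ∧ ConfigA G g vc' S

/-- `G` contains configuration ℬ with respect to `S`. -/
def ContainsB (G : SimpleGraph V) [DecidableRel G.Adj] (g : ℕ) (vc : ZMod g → V)
    (S : Set V) : Prop :=
  ∃ vc' : ZMod g → V, IsCycleLabelling G g vc' ∧ Set.range vc' = Set.range vc ∧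
    Canonical G g vc' S ∧ ConfigB G g vc' S

/-- `G` contains configuration 𝒞 with respect to `S`. -/
def ContainsC (G : SimpleGraph V) [DecidableRel G.Adj] (g : ℕ) (vc : ZMod g → V)
    (S : Set V) : Prop :=
  ∃ vc' : ZMod g → V, IsCycleLabelling G g vc' ∧ Set.range vc' = Set.range vc ∧
    Canonical G g vc' S ∧ ConfigC G g vc' S

/-- `G` contains configuration 𝒟 with respect to `S`. -/
def ContainsD (G : SimpleGraph V) [DecidableRel G.Adj] (g : ℕ) (vc : ZMod g → V)
    (S : Set V) : Prop :=
  ∃ vc' : ZMod g → V, IsCycleLabelling G g vc' ∧ Set.range vc' = Set.range vc ∧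
    Canonical G g vc' S ∧ ConfigD G g vc' S

/-- `G` contains configuration ℰ with respect to `S`. -/
def ContainsE (G : SimpleGraph V) [DecidableRel G.Adj] (g : ℕ) (vc : ZMod g → V)
    (S : Set V) : Prop :=
  ∃ vc' : ZMod g → V, IsCycleLabelling G g vc' ∧ Set.range vc' = Set.range vc ∧
    Canonical G g vc' S ∧ ConfigE G g vc' S

/-- `G` contains one of the configurations 𝒜, ℬ, 𝒞 with respect to `S`. -/
def ContainsABC (G : SimpleGraph V) [DecidableRel G.Adj] (g : ℕ) (vc : ZMod g → V)
    (S : Set V) : Prop :=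
  ContainsA G g vc S ∨ ContainsB G g vc S ∨ ContainsC G g vc S

/-- `G` contains one of the configurations 𝒜, 𝒟, ℰ with respect to `S`. -/
def ContainsADE (G : SimpleGraph V) [DecidableRel G.Adj] (g : ℕ) (vc : ZMod g → V)
    (S : Set V) : Prop :=
  ContainsA G g vc S ∨ ContainsD G g vc S ∨ ContainsE G g vc S

/-- `S` is a smallest branch-resolving set of `G`. -/
def SmallestBR (G : SimpleGraph V) [DecidableRel G.Adj] (S : Finset V) : Prop :=
  BranchResolving G ↑S ∧ ∀ S' : Finset V, BranchResolving G ↑S' → S.card ≤ S'.card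

/-- `S` is a smallest biactive branch-resolving set of `G`. -/
def SmallestBBR (G : SimpleGraph V) [DecidableRel G.Adj] (g : ℕ) (vc : ZMod g → V)
    (S : Finset V) : Prop :=
  BranchResolving G ↑S ∧ Biactive G g vc ↑S ∧
    ∀ S' : Finset V, BranchResolving G ↑S' → Biactive G g vc ↑S' → S.card ≤ S'.card

/-- `G` is 𝒜ℬ𝒞-negative. -/
def ABCneg (G : SimpleGraph V) [DecidableRel G.Adj] (g : ℕ) (vc : ZMod g → V) : Prop :=
  ∃ S : Finset V, SmallestBBR G g vc S ∧ ¬ ContainsABC G g vc ↑S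

/-- `G` is 𝒜𝒟ℰ-negative. -/
def ADEneg (G : SimpleGraph V) [DecidableRel G.Adj] (g : ℕ) (vc : ZMod g → V) : Prop :=
  ∃ S : Finset V, SmallestBBR G g vc S ∧ ¬ ContainsADE G g vc ↑S

end Defs

section CycleStructure

variable {V : Type*} {G : SimpleGraph V} {g : ℕ} {vc : ZMod g → V}

lemma offCycle_adj_of_notMem_range {a b : V} (h : G.Adj a b) (hb : b ∉ Set.range vc) :
    (offCycle G g vc).Adj a b := by
  rw [offCycle, deleteEdges_adj]
  refine ⟨h, ?_⟩
  rintro ⟨i, hi⟩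
  rcases Sym2.eq_iff.1 hi with ⟨-, rfl⟩ | ⟨-, rfl⟩ <;> exact hb ⟨_, rfl⟩

lemma reachable_of_forall_reachable_succ {K : SimpleGraph V} (a : ZMod g) (m : ℕ)
    (h : ∀ n < m, K.Reachable (vc (a + n)) (vc (a + n + 1))) :
    K.Reachable (vc a) (vc (a + m)) := by
  induction m with
  | zero => simp
  | succ m ih =>
    have := (ih fun n hn => h n (by omega)).trans (h m (by omega))
    rwa [add_assoc, ← Nat.cast_succ] at this

lemma natCast_ne_zero_of_lt {n : ℕ} (h0 : 0 < n) (hn : n < g) : (n : ZMod g) ≠ 0 := by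
  rw [Ne, ZMod.natCast_eq_zero_iff]
  exact fun h => absurd (Nat.le_of_dvd h0 h) (by omega)

lemma two_ne_zero_of_three_le (hg : 3 ≤ g) : (2 : ZMod g) ≠ 0 := by
  exact_mod_cast natCast_ne_zero_of_lt (g := g) (n := 2) (by omega) (by omega)

lemma adj_pred_cycle (hvc : IsCycleLabelling G g vc) (i : ZMod g) :
    G.Adj (vc i) (vc (i - 1)) := by
  simpa using (hvc.2 (i - 1)).symm

lemma cycle_succ_ne_pred (hg : 3 ≤ g) (hvc : IsCycleLabelling G g vc) (i : ZMod g) :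
    vc (i + 1) ≠ vc (i - 1) := by
  intro h
  apply two_ne_zero_of_three_le hg
  linear_combination hvc.1 h

/-- The graph formed by the edges of the cycle contains a cycle. -/
lemma not_isAcyclic_fromEdgeSet_cycleEdges (hg : 3 ≤ g) (hvc : IsCycleLabelling G g vc) :
    ¬ (fromEdgeSet (cycleEdges g vc)).IsAcyclic := by
  have adj (i : ZMod g) : (fromEdgeSet (cycleEdges g vc)).Adj (vc i) (vc (i + 1)) :=
    (fromEdgeSet_adj _).2 ⟨⟨i, rfl⟩, (hvc.2 i).ne⟩
  intro hac
  have hbr := isAcyclic_iff_forall_adj_isBridge.1 hac (adj 0)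
  rw [isBridge_iff] at hbr
  apply hbr
  have key := reachable_of_forall_reachable_succ (vc := vc)
    (K := (fromEdgeSet (cycleEdges g vc)).deleteEdges {s(vc 0, vc (0 + 1))}) 1 (g - 1) ?_
  · rw [← Nat.cast_one, ← Nat.cast_add, show 1 + (g - 1) = g by omega] at key
    simpa using key.symm
  · intro n hn
    refine Adj.reachable ?_
    rw [deleteEdges_adj]
    refine ⟨adj _, ?_⟩
    intro h
    rcases Sym2.eq_iff.1 (Set.mem_singleton_iff.1 h) with ⟨h, -⟩ | ⟨h, h'⟩
    · have h := hvc.1 h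
      exact natCast_ne_zero_of_lt (g := g) (n := 1 + n) (by omega) (by omega) (by exact_mod_cast h)
    · have h := hvc.1 h
      have h' := hvc.1 h'
      rw [h] at h'
      apply two_ne_zero_of_three_le hg
      rw [← h']; ring

/-- In a unicyclic graph, every edge outside the cycle is a bridge. -/
lemma isBridge_of_notMem_cycleEdges (hG : IsUnicyclic G) (hg : 3 ≤ g)
    (hvc : IsCycleLabelling G g vc) {e : Sym2 V} (he : e ∈ G.edgeSet)
    (hec : e ∉ cycleEdges g vc) : G.IsBridge e := by
  rw [isBridge_iff_forall_cycle_notMem he]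
  intro u p hp hmem
  have hna := not_isAcyclic_fromEdgeSet_cycleEdges hg hvc
  simp only [IsAcyclic, not_forall, not_not] at hna
  obtain ⟨v, c, hc⟩ := hna
  have hle : fromEdgeSet (cycleEdges g vc) ≤ G := by
    intro a b hab
    obtain ⟨⟨i, hi⟩, -⟩ := (fromEdgeSet_adj _).1 hab
    have : s(a, b) ∈ G.edgeSet := hi ▸ (hvc.2 i)
    exact this
  have := (hG.2.2 _ _ p (c.mapLe hle) hp (hc.mapLe hle) e).1 hmem
  rw [Walk.edges_mapLe_eq_edges] at this
  have := c.edges_subset_edgeSet this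
  rw [edgeSet_fromEdgeSet] at this
  exact hec this.1

lemma offCycle_isAcyclic (hG : IsUnicyclic G) (hg : 3 ≤ g) (hvc : IsCycleLabelling G g vc) :
    (offCycle G g vc).IsAcyclic := by
  rw [isAcyclic_iff_forall_adj_isBridge]
  intro a b hab
  rw [offCycle, deleteEdges_adj] at hab
  exact (isBridge_of_notMem_cycleEdges hG hg hvc hab.1 hab.2).anti (deleteEdges_le _)

/-- The tree hanging at a cycle vertex contains no other cycle vertex. -/
lemma eq_of_inTree_cycle (hG : IsUnicyclic G) (hg : 3 ≤ g) (hvc : IsCycleLabelling G g vc)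
    {i j : ZMod g} (h : inTree G g vc i (vc j)) : i = j := by
  by_contra hij
  obtain ⟨p, hp⟩ := h.exists_isPath
  generalize hw : vc j = w at p
  cases p with
  | nil => exact hij (hvc.1 hw.symm)
  | @cons _ z _ hadj q =>
    rw [Walk.cons_isPath_iff] at hp
    have hadj' := hadj
    rw [offCycle, deleteEdges_adj] at hadj
    have hbr := isBridge_of_notMem_cycleEdges hG hg hvc hadj.1 hadj.2
    rw [isBridge_iff] at hbr
    apply hbr
    have h1 : (G.deleteEdges {s(vc i, z)}).Reachable (vc i) (vc j) := by
      have : NeZero g := ⟨by omega⟩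
      have key := reachable_of_forall_reachable_succ (vc := vc)
        (K := G.deleteEdges {s(vc i, z)}) i (j - i).val ?_
      · simpa using key
      · intro n _
        refine Adj.reachable ?_
        rw [deleteEdges_adj]
        refine ⟨hvc.2 _, fun h => hadj.2 ?_⟩
        rw [← Set.mem_singleton_iff.1 h]
        exact ⟨_, rfl⟩
    rw [hw] at h1
    refine h1.trans (Reachable.symm ⟨q.transfer _ ?_⟩)
    intro e he
    rw [edgeSet_deleteEdges]
    refine ⟨edgeSet_mono (deleteEdges_le _) (q.edges_subset_edgeSet he), ?_⟩
    rintro rfl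
    exact hp.2 (q.fst_mem_support_of_mem_edges he)

end CycleStructure

section Threads

variable {V : Type*} [Fintype V] {G : SimpleGraph V} [DecidableRel G.Adj]

lemma three_le_degree_of_adj {a x y z : V} (hx : G.Adj a x) (hy : G.Adj a y) (hz : G.Adj a z)
    (hxy : x ≠ y) (hxz : x ≠ z) (hyz : y ≠ z) : 3 ≤ G.degree a := by
  rw [← card_neighborFinset_eq_degree]
  exact Finset.two_lt_card.2 ⟨x, by simpa, y, by simpa, z, by simpa, hxy, hxz, hyz⟩

lemma two_le_degree_of_adj {a x y : V} (hx : G.Adj a x) (hy : G.Adj a y) (hxy : x ≠ y) :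
    2 ≤ G.degree a := by
  rw [← card_neighborFinset_eq_degree]
  exact Finset.one_lt_card.2 ⟨x, by simpa, y, by simpa, hxy⟩

/-- Starting from `v`, the vertices of the list lead without turning back through vertices of
degree two to a leaf. -/
inductive LeadsToLeaf (G : SimpleGraph V) [DecidableRel G.Adj] : V → List V → Prop
  | leaf {v a : V} : G.Adj v a → G.degree a = 1 → LeadsToLeaf G v [a]
  | cons {v a b : V} {l : List V} : G.Adj v a → G.degree a = 2 → v ≠ b →
      LeadsToLeaf G a (b :: l) → LeadsToLeaf G v (a :: b :: l)

namespace LeadsToLeaf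

variable {v : V} {t : List V}

lemma adj_head {a : V} {l : List V} (h : LeadsToLeaf G v (a :: l)) : G.Adj v a := by
  cases h <;> assumption

lemma exists_eq_cons (h : LeadsToLeaf G v t) : ∃ a l, t = a :: l := by
  cases h <;> exact ⟨_, _, rfl⟩

lemma degree_le_two (h : LeadsToLeaf G v t) : ∀ u ∈ t, G.degree u ≤ 2 := by
  induction h with
  | leaf _ h1 => simp [h1]
  | cons _ h2 _ _ ih =>
    intro u hu
    rcases List.mem_cons.1 hu with rfl | hu
    · exact h2.le
    · exact ih u hu

lemma mem_or_eq_of_adj (h : LeadsToLeaf G v t) :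
    ∀ u ∈ t, ∀ w, G.Adj u w → w ∈ t ∨ w = v ∧ t.head? = some u := by
  induction h with
  | @leaf v a hadj h1 =>
    intro u hu w huw
    obtain rfl := List.mem_singleton.1 hu
    right
    refine ⟨?_, rfl⟩
    by_contra hne
    have := two_le_degree_of_adj huw hadj.symm hne
    omega
  | @cons v a b l hadj h2 hne hl ih =>
    intro u hu w huw
    rcases List.mem_cons.1 hu with rfl | hu
    · by_contra! hcon
      have hb : w ≠ b := by rintro rfl; simp at hcon
      have hv : w ≠ v := by rintro rfl; simp at hcon
      have := three_le_degree_of_adj huw hadj.symm hl.adj_head hv hb hne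
      omega
    · left
      rcases ih u hu w huw with h | ⟨rfl, -⟩
      · exact List.mem_cons_of_mem _ h
      · exact List.mem_cons_self

lemma eq_of_cons {a : V} {l₁ l₂ : List V} (h₁ : LeadsToLeaf G v (a :: l₁))
    (h₂ : LeadsToLeaf G v (a :: l₂)) : l₁ = l₂ := by
  induction l₁ generalizing v a l₂ with
  | nil =>
    cases h₁
    cases h₂
    · rfl
    · omega
  | cons b l ih =>
    cases h₁ with
    | cons hadj h2 hne hl =>
      cases h₂ with
      | leaf => omega
      | @cons _ _ c l' _ _ hne' hl' =>
        obtain rfl : b = c := by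
          by_contra hbc
          have := three_le_degree_of_adj hadj.symm hl.adj_head hl'.adj_head hne hne' hbc
          omega
        rw [ih hl hl']

lemma subset_of_mem (h : LeadsToLeaf G v t) {X : Set V}
    (hX : ∀ u ∈ X, ∀ w, G.Adj u w → G.degree w ≤ 2 → w ∈ X) {u : V} (hut : u ∈ t) (huX : u ∈ X) :
    ∀ w ∈ t, w ∈ X := by
  induction h generalizing u with
  | leaf =>
    obtain rfl := List.mem_singleton.1 hut
    simpa
  | @cons v a b l hadj h2 hne hl ih =>
    have hall : ∀ w ∈ b :: l, w ∈ X := by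
      rcases List.mem_cons.1 hut with rfl | hut
      · refine ih List.mem_cons_self (hX _ huX _ hl.adj_head ?_)
        exact hl.degree_le_two _ List.mem_cons_self
      · exact ih hut huX
    intro w hw
    rcases List.mem_cons.1 hw with rfl | hw
    · exact hX _ (hall b List.mem_cons_self) _ hl.adj_head.symm h2.le
    · exact hall w hw

lemma eq_of_common_mem {v' : V} {t' : List V} (h : LeadsToLeaf G v t) (h' : LeadsToLeaf G v' t')
    (hv' : 3 ≤ G.degree v') {u : V} (hu : u ∈ t) (hu' : u ∈ t')
    (hv : 3 ≤ G.degree v) : v = v' ∧ t = t' := by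
  have hsub : ∀ w ∈ t', w ∈ {w | w ∈ t} := by
    refine h'.subset_of_mem ?_ hu' hu
    intro x hx w hxw hw
    rcases h.mem_or_eq_of_adj x hx w hxw with h | ⟨rfl, -⟩
    · exact h
    · omega
  obtain ⟨a, l, rfl⟩ := h'.exists_eq_cons
  rcases h.mem_or_eq_of_adj a (hsub a List.mem_cons_self) v' h'.adj_head.symm with hm | ⟨rfl, hh⟩
  · have := h.degree_le_two _ hm
    omega
  · refine ⟨rfl, ?_⟩
    obtain ⟨b, l', rfl⟩ := h.exists_eq_cons
    simp only [List.head?_cons, Option.some.injEq] at hh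
    subst hh
    rw [h.eq_of_cons h']

end LeadsToLeaf

lemma IsThreadAt.leadsToLeaf {v : V} {t : List V} (h : IsThreadAt G v t) : LeadsToLeaf G v t := by
  obtain ⟨hne, hnd, hv, -, hch, hhd, hlast, hdrop⟩ := h
  induction t generalizing v with
  | nil => exact absurd rfl hne
  | cons a l ih =>
    cases l with
    | nil => exact .leaf (hhd a rfl) (hlast a rfl)
    | cons b l =>
      refine .cons (hhd a rfl) (hdrop a (by simp)) (by rintro rfl; simp at hv) ?_
      have hch' := List.isChain_cons_cons.1 hch
      refine ih (by simp) hnd.of_cons (List.nodup_cons.1 hnd).1 hch'.2 ?_ ?_ ?_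
      · simpa using hch'.1
      · simpa [List.getLast?_cons_cons] using hlast
      · intro u hu
        exact hdrop u (by simp [List.dropLast_cons_cons, hu])

lemma LeadsToLeaf.isThreadAt {v : V} {t : List V} (h : LeadsToLeaf G v t) (hnd : t.Nodup)
    (hdeg : 3 ≤ G.degree v) : IsThreadAt G v t := by
  have hvt : v ∉ t := fun hv => by
    have := h.degree_le_two v hv
    omega
  have key : t.IsChain G.Adj ∧ (∀ u ∈ t.getLast?, G.degree u = 1) ∧
      ∀ u ∈ t.dropLast, G.degree u = 2 := by
    clear hnd hdeg hvt
    induction h with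
    | leaf _ h1 => simp [h1]
    | cons _ h2 _ hl ih =>
      refine ⟨List.isChain_cons_cons.2 ⟨hl.adj_head, ih.1⟩, ?_, ?_⟩
      · simpa [List.getLast?_cons_cons] using ih.2.1
      · simpa [List.dropLast_cons_cons, h2] using ih.2.2
  obtain ⟨a, l, rfl⟩ := h.exists_eq_cons
  exact ⟨by simp, hnd, hvt, hdeg, key.1, by simpa using h.adj_head, key.2⟩

lemma IsThreadAt.three_le_degree {v : V} {t : List V} (h : IsThreadAt G v t) : 3 ≤ G.degree v :=
  h.2.2.2.1

lemma IsThreadAt.eq_of_common_mem {v v' : V} {t t' : List V} (h : IsThreadAt G v t)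
    (h' : IsThreadAt G v' t') {u : V} (hu : u ∈ t) (hu' : u ∈ t') : v = v' ∧ t = t' :=
  h.leadsToLeaf.eq_of_common_mem h'.leadsToLeaf h'.three_le_degree hu hu' h.three_le_degree

variable {g : ℕ} {vc : ZMod g → V}

lemma LeadsToLeaf.notMem_range (hg : 3 ≤ g) (hvc : IsCycleLabelling G g vc) {v : V} {t : List V}
    (h : LeadsToLeaf G v t) : ∀ u ∈ t, u ∉ Set.range vc := by
  induction h with
  | @leaf v a _ h1 =>
    intro u hu
    obtain rfl := List.mem_singleton.1 hu
    rintro ⟨i, rfl⟩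
    have := two_le_degree_of_adj (hvc.2 i) (adj_pred_cycle hvc i) (cycle_succ_ne_pred hg hvc i)
    omega
  | @cons v a b l _ h2 _ hl ih =>
    intro u hu
    rcases List.mem_cons.1 hu with rfl | hu
    · rintro ⟨i, rfl⟩
      have hb := ih b List.mem_cons_self
      have := three_le_degree_of_adj (hvc.2 i) (adj_pred_cycle hvc i) hl.adj_head
        (cycle_succ_ne_pred hg hvc i) (fun h => hb ⟨_, h⟩) (fun h => hb ⟨_, h⟩)
      omega
    · exact ih u hu

lemma LeadsToLeaf.reachable_offCycle (hg : 3 ≤ g) (hvc : IsCycleLabelling G g vc) {v : V}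
    {t : List V} (h : LeadsToLeaf G v t) : ∀ u ∈ t, (offCycle G g vc).Reachable v u := by
  have hnot := h.notMem_range hg hvc
  induction h with
  | leaf hadj _ =>
    intro u hu
    obtain rfl := List.mem_singleton.1 hu
    exact (offCycle_adj_of_notMem_range hadj (hnot _ hu)).reachable
  | cons hadj _ _ _ ih =>
    have hva := (offCycle_adj_of_notMem_range hadj (hnot _ List.mem_cons_self)).reachable
    intro u hu
    rcases List.mem_cons.1 hu with rfl | hu
    · exact hva
    · exact hva.trans (ih (fun w hw => hnot w (List.mem_cons_of_mem _ hw)) u hu)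

/-- A path in an acyclic subgraph beyond which only vertices of degree at most two occur extends
along any new neighbour to a leaf. -/
lemma exists_leadsToLeaf {H : SimpleGraph V} (hle : H ≤ G) (hac : H.IsAcyclic) {r : V} {N : ℕ}
    (hN : ∀ (z : V) (q : H.Walk r z), q.IsPath → N < q.length →
      G.degree z ≤ 2 ∧ ∀ w, G.Adj z w → H.Adj z w)
    {x y : V} (p : H.Walk r x) (hp : p.IsPath) (hNp : N ≤ p.length) (hxy : H.Adj x y)
    (hy : y ∉ p.support) :
    ∃ l, LeadsToLeaf G x (y :: l) ∧ (y :: l).Nodup ∧ ∀ u ∈ y :: l, u ∉ p.support := by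
  induction hn : Fintype.card V - p.length generalizing x y p with
  | zero =>
    have := hp.length_lt
    omega
  | succ n ih =>
    have hq : (p.concat hxy).IsPath := hp.concat hy hxy
    obtain ⟨hdeg, hadj⟩ := hN y (p.concat hxy) hq (by simp; omega)
    by_cases hz : ∃ z, G.Adj y z ∧ z ≠ x
    · obtain ⟨z, hyz, hzx⟩ := hz
      have hzs : z ∉ (p.concat hxy).support := fun h =>
        hzx ((hac.eq_penultimate_of_adj_end hq (hadj z hyz) h).trans (by simp))
      obtain ⟨l, hl, hnd, hdisj⟩ := ih (p.concat hxy) hq (by simp; omega) (hadj z hyz) hzs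
        (by simp; omega)
      have hdeg2 : G.degree y = 2 :=
        le_antisymm hdeg (two_le_degree_of_adj hyz (hle hxy).symm hzx)
      refine ⟨z :: l, .cons (hle hxy) hdeg2 hzx.symm hl, ?_, ?_⟩
      · refine List.nodup_cons.2 ⟨fun h => hdisj y h (by simp), hnd⟩
      · intro u hu
        rcases List.mem_cons.1 hu with rfl | hu
        · exact hy
        · intro hus
          exact hdisj u hu (by simp [Walk.support_concat, hus])
    · push Not at hz
      refine ⟨[], .leaf (hle hxy) ?_, by simp, by simpa⟩
      rw [degree_eq_one_iff_existsUnique_adj]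
      exact ⟨x, (hle hxy).symm, hz⟩

end Threads

section Activity

variable {V : Type*} [Fintype V] {G : SimpleGraph V} [DecidableRel G.Adj] {g : ℕ}
  {vc : ZMod g → V}

lemma inTree_of_mem_thread (hg : 3 ≤ g) (hvc : IsCycleLabelling G g vc) {i : ZMod g} {v u : V}
    {t : List V} (ht : IsThreadAt G v t) (hu : u ∈ t) :
    inTree G g vc i u ↔ inTree G g vc i v :=
  have hr := ht.leadsToLeaf.reachable_offCycle hg hvc u hu
  ⟨fun h => h.trans hr.symm, fun h => h.trans hr⟩

lemma branching_of_two_threads (hg : 3 ≤ g) (hvc : IsCycleLabelling G g vc) {v : V}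
    {t₁ t₂ : List V} (h₁ : IsThreadAt G v t₁) (h₂ : IsThreadAt G v t₂) (hne : t₁ ≠ t₂) :
    Branching G g vc v := by
  classical
  by_cases hv : v ∈ Set.range vc
  · refine Or.inr ⟨hv, ?_⟩
    obtain ⟨i, rfl⟩ := hv
    have n₁ := h₁.leadsToLeaf.notMem_range hg hvc
    have n₂ := h₂.leadsToLeaf.notMem_range hg hvc
    obtain ⟨a, l, rfl⟩ := h₁.leadsToLeaf.exists_eq_cons
    obtain ⟨b, l', rfl⟩ := h₂.leadsToLeaf.exists_eq_cons
    have hab : a ≠ b := by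
      rintro rfl
      exact hne (h₁.eq_of_common_mem h₂ List.mem_cons_self List.mem_cons_self).2
    have ha (j : ZMod g) : a ≠ vc j := fun h => n₁ a List.mem_cons_self ⟨j, h.symm⟩
    have hb (j : ZMod g) : b ≠ vc j := fun h => n₂ b List.mem_cons_self ⟨j, h.symm⟩
    rw [← card_neighborFinset_eq_degree]
    have hsub : ({a, b, vc (i + 1), vc (i - 1)} : Finset V) ⊆ G.neighborFinset (vc i) := by
      intro y hy
      simp only [Finset.mem_insert, Finset.mem_singleton] at hy
      rw [mem_neighborFinset]
      rcases hy with rfl | rfl | rfl | rfl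
      · exact h₁.leadsToLeaf.adj_head
      · exact h₂.leadsToLeaf.adj_head
      · exact hvc.2 i
      · exact adj_pred_cycle hvc i
    refine le_trans (le_of_eq ?_) (Finset.card_le_card hsub)
    rw [Finset.card_insert_of_notMem (by simp [ha, hab]),
      Finset.card_insert_of_notMem (by simp [hb]),
      Finset.card_pair (cycle_succ_ne_pred hg hvc i)]
  · exact Or.inl ⟨hv, h₁.three_le_degree⟩

lemma exists_two_threads_of_branchActive (hG : IsUnicyclic G) (hg : 3 ≤ g)
    (hvc : IsCycleLabelling G g vc) {i : ZMod g} (hi : BranchActive G g vc i) :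
    ∃ x t₁ t₂, inTree G g vc i x ∧ IsThreadAt G x t₁ ∧ IsThreadAt G x t₂ ∧ t₁ ≠ t₂ := by
  classical
  let P : Set ℕ := {n | ∃ (x : V) (p : (offCycle G g vc).Walk (vc i) x),
    p.IsPath ∧ Branching G g vc x ∧ p.length = n}
  have hPne : P.Nonempty := by
    obtain ⟨x, hx, hb⟩ := hi
    obtain ⟨p, hp⟩ := Reachable.exists_isPath hx
    exact ⟨_, x, p, hp, hb, rfl⟩
  have hPbdd : BddAbove P := ⟨Fintype.card V, by
    rintro _ ⟨x, p, hp, -, rfl⟩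
    exact hp.length_lt.le⟩
  obtain ⟨x, p, hp, hb, hlen⟩ := Nat.sSup_mem hPne hPbdd
  have hac := offCycle_isAcyclic hG hg hvc
  have hle : offCycle G g vc ≤ G := deleteEdges_le _
  have hN (z : V) (q : (offCycle G g vc).Walk (vc i) z) (hq : q.IsPath)
      (hpq : p.length < q.length) :
      G.degree z ≤ 2 ∧ ∀ w, G.Adj z w → (offCycle G g vc).Adj z w := by
    have hzr : z ∉ Set.range vc := by
      rintro ⟨j, rfl⟩
      obtain rfl := eq_of_inTree_cycle hG hg hvc q.reachable
      rw [Walk.isPath_iff_nil, ← Walk.eq_nil_iff_nil] at hq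
      simp [hq] at hpq
    refine ⟨?_, fun w hw => (offCycle_adj_of_notMem_range hw.symm hzr).symm⟩
    by_contra! hdeg
    have : q.length ≤ sSup P := le_csSup hPbdd ⟨z, q, hq, Or.inl ⟨hzr, hdeg⟩, rfl⟩
    omega
  obtain ⟨F, hF, hFadj⟩ : ∃ F : Finset V, 1 < F.card ∧
      ∀ y ∈ F, (offCycle G g vc).Adj x y ∧ y ∉ p.support := by
    rcases hb with ⟨hxr, hdeg⟩ | ⟨⟨j, rfl⟩, hdeg⟩
    · refine ⟨(G.neighborFinset x).erase p.penultimate, ?_, ?_⟩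
      · have := Finset.pred_card_le_card_erase (s := G.neighborFinset x) (a := p.penultimate)
        rw [card_neighborFinset_eq_degree] at this
        omega
      · intro y hy
        rw [Finset.mem_erase, mem_neighborFinset] at hy
        have hadj := (offCycle_adj_of_notMem_range hy.2.symm hxr).symm
        exact ⟨hadj, fun h => hy.1 (hac.eq_penultimate_of_adj_end hp hadj h)⟩
    · obtain rfl := eq_of_inTree_cycle hG hg hvc p.reachable
      rw [Walk.isPath_iff_nil, ← Walk.eq_nil_iff_nil] at hp
      refine ⟨G.neighborFinset (vc i) \ {vc (i + 1), vc (i - 1)}, ?_, ?_⟩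
      · have h1 := Finset.le_card_sdiff {vc (i + 1), vc (i - 1)} (G.neighborFinset (vc i))
        have h2 := Finset.card_le_two (a := vc (i + 1)) (b := vc (i - 1))
        rw [card_neighborFinset_eq_degree] at h1
        omega
      · intro y hy
        simp only [Finset.mem_sdiff, mem_neighborFinset, Finset.mem_insert,
          Finset.mem_singleton, not_or] at hy
        obtain ⟨hadj, hy1, hy2⟩ := hy
        constructor
        · rw [offCycle, deleteEdges_adj]
          refine ⟨hadj, ?_⟩
          rintro ⟨k, hk⟩
          rcases Sym2.eq_iff.1 hk with ⟨h, h'⟩ | ⟨h, h'⟩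
          · rw [hvc.1 h] at hy1
            exact hy1 h'
          · rw [hvc.1 h] at hy2
            simp [h'] at hy2
        · rw [hp]
          simpa using hadj.ne'
  obtain ⟨y₁, hy₁, y₂, hy₂, hne⟩ := Finset.one_lt_card.1 hF
  obtain ⟨l₁, ht₁, hnd₁, -⟩ :=
    exists_leadsToLeaf hle hac hN p hp le_rfl (hFadj y₁ hy₁).1 (hFadj y₁ hy₁).2
  obtain ⟨l₂, ht₂, hnd₂, -⟩ :=
    exists_leadsToLeaf hle hac hN p hp le_rfl (hFadj y₂ hy₂).1 (hFadj y₂ hy₂).2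
  have hdeg : 3 ≤ G.degree x := by
    rcases hb with ⟨-, h⟩ | ⟨-, h⟩ <;> omega
  refine ⟨x, _, _, p.reachable, ht₁.isThreadAt hnd₁ hdeg, ht₂.isThreadAt hnd₂ hdeg, ?_⟩
  simp [hne]

lemma BranchResolving.sActive_of_branchActive (hG : IsUnicyclic G) (hg : 3 ≤ g)
    (hvc : IsCycleLabelling G g vc) {S : Set V} (hS : BranchResolving G S) {i : ZMod g}
    (hi : BranchActive G g vc i) : SActive G g vc S i := by
  obtain ⟨x, t₁, t₂, hx, h₁, h₂, hne⟩ := exists_two_threads_of_branchActive hG hg hvc hi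
  rcases hS x t₁ t₂ h₁ h₂ hne with ⟨s, hs, hst⟩ | ⟨s, hs, hst⟩
  · exact ⟨s, hs, (inTree_of_mem_thread hg hvc h₁ hst).2 hx⟩
  · exact ⟨s, hs, (inTree_of_mem_thread hg hvc h₂ hst).2 hx⟩

lemma BranchResolving.biactive (hG : IsUnicyclic G) (hg : 3 ≤ g) (hvc : IsCycleLabelling G g vc)
    (hb : 2 ≤ bG G g vc) {S : Set V} (hS : BranchResolving G S) : Biactive G g vc S := by
  have : NeZero g := ⟨by omega⟩
  exact hb.trans (Set.ncard_le_ncard fun i hi => hS.sActive_of_branchActive hG hg hvc hi)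

lemma SmallestBBR.smallestBR (hG : IsUnicyclic G) (hg : 3 ≤ g) (hvc : IsCycleLabelling G g vc)
    (hb : 2 ≤ bG G g vc) {S : Finset V} (hS : SmallestBBR G g vc S) : SmallestBR G S :=
  ⟨hS.1, fun S' hS' => hS.2.2 S' hS' (hS'.biactive hG hg hvc hb)⟩

/-- Every element of a smallest branch-resolving set separates two threads. -/
lemma SmallestBR.exists_two_threads {S : Finset V} (hS : SmallestBR G S) {s : V} (hs : s ∈ S) :
    ∃ v t₁ t₂, IsThreadAt G v t₁ ∧ IsThreadAt G v t₂ ∧ t₁ ≠ t₂ ∧ s ∈ t₁ := by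
  classical
  by_contra! hcon
  have hlt := Finset.card_erase_lt_of_mem hs
  refine absurd (hS.2 (S.erase s) ?_) (by omega)
  intro v t₁ t₂ h₁ h₂ hne
  rcases hS.1 v t₁ t₂ h₁ h₂ hne with ⟨x, hx, hxt⟩ | ⟨x, hx, hxt⟩
  · refine Or.inl ⟨x, Finset.mem_coe.2 (Finset.mem_erase.2 ⟨?_, hx⟩), hxt⟩
    rintro rfl
    exact hcon v t₁ t₂ h₁ h₂ hne hxt
  · refine Or.inr ⟨x, Finset.mem_coe.2 (Finset.mem_erase.2 ⟨?_, hx⟩), hxt⟩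
    rintro rfl
    exact hcon v t₂ t₁ h₂ h₁ hne.symm hxt

lemma SmallestBR.sActive_iff_branchActive (hG : IsUnicyclic G) (hg : 3 ≤ g)
    (hvc : IsCycleLabelling G g vc) {S : Finset V} (hS : SmallestBR G S) (i : ZMod g) :
    SActive G g vc S i ↔ BranchActive G g vc i := by
  refine ⟨?_, hS.1.sActive_of_branchActive hG hg hvc⟩
  rintro ⟨s, hs, hsi⟩
  obtain ⟨v, t₁, t₂, h₁, h₂, hne, hst⟩ := hS.exists_two_threads hs
  exact ⟨v, (inTree_of_mem_thread hg hvc h₁ hst).1 hsi,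
    branching_of_two_threads hg hvc h₁ h₂ hne⟩

lemma SmallestBR.sActive_congr (hG : IsUnicyclic G) (hg : 3 ≤ g) (hvc : IsCycleLabelling G g vc)
    {S S' : Finset V} (hS : SmallestBR G S) (hS' : SmallestBR G S') (i : ZMod g) :
    SActive G g vc S i ↔ SActive G g vc S' i :=
  (hS.sActive_iff_branchActive hG hg hvc i).trans (hS'.sActive_iff_branchActive hG hg hvc i).symm

/-- A smallest branch-resolving set leaves a free thread wherever some thread hangs. -/
lemma SmallestBR.exists_sFree {S : Finset V} (hS : SmallestBR G S) {v : V} {t₀ : List V}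
    (ht₀ : IsThreadAt G v t₀) : ∃ t, IsThreadAt G v t ∧ SFree (S : Set V) t := by
  classical
  by_contra! hcon
  have hit (t : List V) (ht : IsThreadAt G v t) : ∃ s ∈ S, s ∈ t := by
    have := hcon t ht
    simp only [SFree, not_forall, not_not] at this
    obtain ⟨s, hst, hs⟩ := this
    exact ⟨s, hs, hst⟩
  obtain ⟨s, hs, hst₀⟩ := hit t₀ ht₀
  have hlt := Finset.card_erase_lt_of_mem hs
  refine absurd (hS.2 (S.erase s) ?_) (by omega)
  have key (w : V) (t₁ t₂ : List V) (h₁ : IsThreadAt G w t₁) (h₂ : IsThreadAt G w t₂)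
      (hne : t₁ ≠ t₂) (x : V) (hx : x ∈ S) (hxt : x ∈ t₁) :
      (∃ y ∈ (↑(S.erase s) : Set V), y ∈ t₁) ∨ ∃ y ∈ (↑(S.erase s) : Set V), y ∈ t₂ := by
    by_cases hxs : x = s
    · subst hxs
      obtain ⟨rfl, rfl⟩ := h₁.eq_of_common_mem ht₀ hxt hst₀
      obtain ⟨y, hy, hyt⟩ := hit t₂ h₂
      refine Or.inr ⟨y, Finset.mem_coe.2 (Finset.mem_erase.2 ⟨?_, hy⟩), hyt⟩
      rintro rfl
      exact hne (h₁.eq_of_common_mem h₂ hxt hyt).2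
    · exact Or.inl ⟨x, Finset.mem_coe.2 (Finset.mem_erase.2 ⟨hxs, hx⟩), hxt⟩
  intro w t₁ t₂ h₁ h₂ hne
  rcases hS.1 w t₁ t₂ h₁ h₂ hne with ⟨x, hx, hxt⟩ | ⟨x, hx, hxt⟩
  · exact key w t₁ t₂ h₁ h₂ hne x hx hxt
  · exact (key w t₂ t₁ h₂ h₁ hne.symm x hx hxt).symm

end Activity

section Configurations

lemma kOf_congr {V : Type*} {G : SimpleGraph V} {g : ℕ} {vc : ZMod g → V} {S S' : Set V}
    (h : ∀ i, SActive G g vc S i ↔ SActive G g vc S' i) : kOf G g vc S = kOf G g vc S' := by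
  simp only [kOf, h]

lemma aS_congr {V : Type*} {G : SimpleGraph V} {g : ℕ} {vc : ZMod g → V} {S S' : Set V}
    (h : ∀ i, SActive G g vc S i ↔ SActive G g vc S' i) : aS G g vc S = aS G g vc S' := by
  simp only [aS, h]

/-- If only two cycle vertices are active, no index strictly between `0` and `k` is active. -/
lemma eq_zero_or_eq_kOf {V : Type*} {G : SimpleGraph V} {g : ℕ} {vc : ZMod g → V} {S : Set V}
    (hg : 3 ≤ g) (h0 : SActive G g vc S 0) (ha : aS G g vc S = 2) {i : ℕ}
    (hik : i ≤ kOf G g vc S) (hi : SActive G g vc S i) : i = 0 ∨ i = kOf G g vc S := by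
  by_contra! hcon
  have hmem : kOf G g vc S ∈ {n : ℕ | n < g ∧ SActive G g vc S (n : ZMod g)} :=
    Nat.sSup_mem ⟨0, by omega, by simpa using h0⟩ ⟨g, fun n hn => hn.1.le⟩
  obtain ⟨hk, hka⟩ := hmem
  have inj {m n : ℕ} (hm : m < g) (hn : n < g) (hmn : m ≠ n) : (m : ZMod g) ≠ n := by
    rw [Ne, ZMod.natCast_eq_natCast_iff']
    rwa [Nat.mod_eq_of_lt hm, Nat.mod_eq_of_lt hn]
  have : NeZero g := ⟨by omega⟩
  have h3 : 2 < {j : ZMod g | SActive G g vc S j}.ncard := by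
    rw [Set.two_lt_ncard_iff]
    refine ⟨(0 : ℕ), i, kOf G g vc S, by simpa using h0, hi, hka, ?_, ?_, ?_⟩ <;>
      apply inj <;> omega
  rw [aS] at ha
  omega

variable {V : Type*} [Fintype V] {G : SimpleGraph V} [DecidableRel G.Adj] {g : ℕ}
  {vc : ZMod g → V}

lemma SmallestBR.canonical {S S' : Finset V} (hG : IsUnicyclic G) (hg : 3 ≤ g)
    (hS : SmallestBR G S) (hS' : SmallestBR G S') (h : Canonical G g vc S) :
    Canonical G g vc S' := by
  have hact {w : ZMod g → V} (hw : IsCycleLabelling G g w) := hS.sActive_congr hG hg hw hS'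
  obtain ⟨hvc, h0, hmin⟩ := h
  refine ⟨hvc, (hact hvc 0).1 h0, fun w hw hr hw0 => ?_⟩
  rw [← kOf_congr (hact hvc), ← kOf_congr (hact hw)]
  exact hmin w hw hr ((hact hw 0).2 hw0)

lemma SmallestBR.containsABC {S S' : Finset V} (hG : IsUnicyclic G) (hg : 3 ≤ g)
    (hS : SmallestBR G S) (hS' : SmallestBR G S') (h : ContainsABC G g vc S) :
    ContainsABC G g vc S' := by
  have hact {w : ZMod g → V} (hw : IsCycleLabelling G g w) := hS.sActive_congr hG hg hw hS'
  rcases h with ⟨w, hw, hr, hc, hA⟩ | ⟨w, hw, hr, hc, hB⟩ | ⟨w, hw, hr, hc, hC⟩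
  · refine Or.inl ⟨w, hw, hr, hS.canonical hG hg hS' hc, ?_⟩
    rwa [ConfigA, ← aS_congr (hact hw), ← kOf_congr (hact hw)]
  · refine Or.inr (Or.inl ⟨w, hw, hr, hS.canonical hG hg hS' hc, ?_⟩)
    rw [ConfigB, ← kOf_congr (hact hw)]
    obtain ⟨hk, i, hi, t, ht, -⟩ := hB
    exact ⟨hk, i, hi, hS'.exists_sFree ht⟩
  · have hc' := hS.canonical hG hg hS' hc
    obtain ⟨ha, hev, hk, i, hik, t, ht, hfree, hlen⟩ := hC
    obtain ⟨t', ht', hfree'⟩ := hS'.exists_sFree ht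
    by_cases htt : t' = t
    · subst htt
      refine Or.inr (Or.inr ⟨w, hw, hr, hc', ?_⟩)
      rw [ConfigC, ← aS_congr (hact hw), ← kOf_congr (hact hw)]
      exact ⟨ha, hev, hk, i, hik, t', ht', hfree', hlen⟩
    have hia : SActive G g w S i := (hS.sActive_iff_branchActive hG hg hw i).2
      ⟨w i, Reachable.rfl, branching_of_two_threads hg hw ht' ht htt⟩
    have h0k := eq_zero_or_eq_kOf hg hc.2.1 ha hik hia
    rcases hk.eq_or_lt with hk | hk
    · refine Or.inl ⟨w, hw, hr, hc', ?_⟩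
      rw [ConfigA, ← aS_congr (hact hw), ← kOf_congr (hact hw)]
      exact ⟨ha, hev, hk⟩
    · refine Or.inr (Or.inl ⟨w, hw, hr, hc', ?_⟩)
      rw [ConfigB, ← kOf_congr (hact hw)]
      exact ⟨by omega, i, by omega, t', ht', hfree'⟩

end Configurations

theorem statement_14 {V : Type*} [Fintype V] [DecidableEq V] (G : SimpleGraph V)
    [DecidableRel G.Adj] (hG : IsUnicyclic G) (g : ℕ) (hg : 3 ≤ g)
    (vc : ZMod g → V) (hvc : IsCycleLabelling G g vc)
    (hb : 2 ≤ bG G g vc) :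
    ∀ S S' : Finset V, SmallestBBR G g vc S → SmallestBBR G g vc S' →
      (ContainsABC G g vc ↑S ↔ ContainsABC G g vc ↑S') := by
  intro S S' hS hS'
  have h := hS.smallestBR hG hg hvc hb
  have h' := hS'.smallestBR hG hg hvc hb
  exact ⟨h.containsABC hG hg h', h'.containsABC hG hg h⟩
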